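/- Let ℓ be a prime with ℓ ≡ 3 (mod 4) and let p ≠ ℓ be a prime with p ≡ 3 (mod 4). Then for any power q = p^n of p, the curve H_ℓ is maximal over 𝔽_{q²} if and only if q ≡ 3 (mod 4) and q ≡ ±1 (mod ℓ). -/

import Mathlib

open Polynomial

/-- Number of affine points (x,y) ∈ F × F with y² = φ_d(x), where φ_d is the
d-th Chebyshev (Dickson first kind, parameter 1) polynomial over F. -/
noncomputable def chebAffineCount (F : Type) [Field F] (d : ℕ) : ℕ :=
  Nat.card {xy : F × F // xy.2 ^ 2 = (dickson 1 (1 : F) d).eval xy.1}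

/-- The hyperelliptic curve H_d : y² = φ_d(x) is maximal over the field with q² elements:
its affine point count attains q² + (d-1)q (Hasse–Weil bound minus the point at infinity). -/
def chebMaximal (d q : ℕ) : Prop :=
  ∀ (F : Type) [Field F] [Fintype F], Fintype.card F = q ^ 2 →
    chebAffineCount F d = q ^ 2 + (d - 1) * q


set_option linter.unusedSectionVars false
section basics
variable {F : Type*} [Field F] [Fintype F] [DecidableEq F]

lemma two_ne' (hF : ringChar F ≠ 2) : (2 : F) ≠ 0 := Ring.two_ne_zero hF

lemma conv_sum (hF : ringChar F ≠ 2) (g : F → ℤ) :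
    ∑ t : Fˣ, g ((t : F) + ((t⁻¹ : Fˣ) : F)) =
      ∑ x : F, (1 + quadraticChar F (x ^ 2 - 4)) * g x := by
  have h2 := two_ne' hF
  rw [← Finset.sum_fiberwise_of_maps_to (s := Finset.univ) (t := Finset.univ)
    (g := fun t : Fˣ => (t : F) + ((t⁻¹ : Fˣ) : F)) (fun _ _ => Finset.mem_univ _)]
  refine Finset.sum_congr rfl fun x _ => ?_
  rw [Finset.sum_congr rfl (g := fun _ => g x) (fun t ht => by
    rw [(Finset.mem_filter.mp ht).2]), Finset.sum_const, nsmul_eq_mul]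
  congr 1
  rw [add_comm, ← quadraticChar_card_sqrts hF]
  norm_cast
  refine Finset.card_bij (fun t _ => 2 * (t : F) - x) ?_ ?_ ?_
  · intro t ht
    have hx := (Finset.mem_filter.mp ht).2
    simp only [Set.mem_toFinset, Set.mem_ofPred_eq]
    have : (t : F) * ((t⁻¹ : Fˣ) : F) = 1 := by simp
    rw [← hx]; linear_combination (-4 : F) * this
  · intro t _ s _ h
    ext
    have : 2 * (t : F) = 2 * s := by linear_combination h
    exact mul_left_cancel₀ h2 this
  · intro y hy
    simp only [Set.mem_toFinset, Set.mem_ofPred_eq] at hy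
    have key : ((x + y) / 2) * ((x - y) / 2) = 1 := by
      field_simp; linear_combination -hy
    refine ⟨⟨(x + y) / 2, (x - y) / 2, key, by rw [mul_comm]; exact key⟩, ?_, ?_⟩
    · simp only [Finset.mem_filter, Finset.mem_univ, true_and]
      simp
      field_simp; ring
    · simp; field_simp; ring

lemma dick_eval (t : Fˣ) (d : ℕ) :
    (dickson 1 (1 : F) d).eval ((t : F) + ((t⁻¹ : Fˣ) : F)) =
      (t : F) ^ d + ((t⁻¹ : Fˣ) : F) ^ d :=
  dickson_one_one_eval_add_inv _ _ (by simp) d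

lemma affine_count (hF : ringChar F ≠ 2) (f : F → F) :
    (Nat.card {xy : F × F // xy.2 ^ 2 = f xy.1} : ℤ) =
      Fintype.card F + ∑ x, quadraticChar F (f x) := by
  have e : {xy : F × F // xy.2 ^ 2 = f xy.1} ≃ Σ x : F, {y : F // y ^ 2 = f x} :=
    { toFun := fun a => ⟨a.1.1, a.1.2, a.2⟩
      invFun := fun a => ⟨(a.1, a.2.1), a.2.2⟩
      left_inv := fun _ => rfl
      right_inv := fun _ => rfl }
  rw [Nat.card_congr e, Nat.card_sigma]
  push_cast
  have : (Fintype.card F : ℤ) = ∑ x : F, 1 := by simp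
  rw [this, ← Finset.sum_add_distrib]
  refine Finset.sum_congr rfl fun x _ => ?_
  rw [add_comm, ← quadraticChar_card_sqrts hF, Set.toFinset_card, Nat.card_eq_fintype_card]
  norm_cast

lemma chi_one_of_pow {a : F} (ha : a ^ (Fintype.card F / 2) = 1) (hF : ringChar F ≠ 2)
    (h0 : a ≠ 0) : quadraticChar F a = 1 :=
  (quadraticChar_one_iff_isSquare h0).2 ((FiniteField.isSquare_iff hF h0).2 ha)

lemma card_pow_eq {m : ℕ} (hm : m ∣ Fintype.card F - 1) (hm0 : 0 < m) :
    (Finset.univ.filter fun t : Fˣ => t ^ m = 1).card = m := by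
  obtain ⟨g, hg⟩ := IsCyclic.exists_ofOrder_eq_natCard (α := Fˣ)
  rw [Nat.card_eq_fintype_card, Fintype.card_units] at hg
  obtain ⟨k, hk⟩ := hm
  have hpos : 0 < Fintype.card F - 1 := by
    have := Fintype.one_lt_card (α := F); omega
  have hk0 : k ≠ 0 := by rintro rfl; omega
  have ho : orderOf (g ^ k) = m := by
    rw [orderOf_pow_of_dvd hk0 (by rw [hg, hk]; exact dvd_mul_left _ _), hg, hk]
    exact Nat.mul_div_cancel _ (Nat.pos_of_ne_zero hk0)
  apply le_antisymm
  · exact IsCyclic.card_pow_eq_one_le hm0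
  · conv_lhs => rw [← Finset.card_range m]
    refine Finset.card_le_card_of_injOn (fun i => (g ^ k) ^ i) ?_ ?_
    · intro i _
      simp only [Finset.coe_filter, Finset.mem_univ, true_and, Set.mem_ofPred_eq]
      rw [← pow_mul, mul_comm, pow_mul]
      conv_lhs => rw [← ho, pow_orderOf_eq_one, one_pow]
    · have := pow_injOn_Iio_orderOf (x := g ^ k)
      rw [ho] at this
      simpa using this

lemma card_neg_one {d : ℕ} (hF : ringChar F ≠ 2) (hm : 4 * d ∣ Fintype.card F - 1) (hd : 0 < d) :
    (Finset.univ.filter fun t : Fˣ => (t : F) ^ (2 * d) = -1).card = 2 * d := by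
  have h1 := card_pow_eq (F := F) hm (by omega)
  have h2 := card_pow_eq (F := F) (m := 2 * d) ((Dvd.intro 2 (by ring)).trans hm) (by omega)
  have h3 : (Finset.univ.filter fun t : Fˣ => t ^ (4 * d) = 1) =
      (Finset.univ.filter fun t : Fˣ => t ^ (2 * d) = 1) ∪
      (Finset.univ.filter fun t : Fˣ => (t : F) ^ (2 * d) = -1) := by
    ext t
    simp only [Finset.mem_filter, Finset.mem_univ, true_and, Finset.mem_union, Units.ext_iff,
      Units.val_pow_eq_pow_val, Units.val_one]
    rw [← mul_self_eq_one_iff, ← sq, ← pow_mul, show 2 * d * 2 = 4 * d by ring]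
  rw [h3, Finset.card_union_of_disjoint, h2] at h1
  · omega
  · rw [Finset.disjoint_filter]
    intro t _ h h'
    have : (t : F) ^ (2 * d) = 1 := by rw [← Units.val_pow_eq_pow_val, h]; rfl
    rw [this] at h'
    apply two_ne' hF
    linear_combination h'


lemma chi_unit_sq (t : Fˣ) : quadraticChar F (t : F) * quadraticChar F (t : F) = 1 := by
  rw [← sq]; exact quadraticChar_sq_one t.ne_zero

lemma chi_pow_even (t : Fˣ) {m : ℕ} (hm : m % 2 = 0) : quadraticChar F ((t : F) ^ m) = 1 := by
  obtain ⟨k, rfl⟩ : ∃ k, m = 2 * k := ⟨m / 2, by omega⟩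
  rw [map_pow, pow_mul, sq, chi_unit_sq, one_pow]

lemma chi_pow_odd (t : Fˣ) {m : ℕ} (hm : m % 2 = 1) :
    quadraticChar F ((t : F) ^ m) = quadraticChar F (t : F) := by
  obtain ⟨k, rfl⟩ : ∃ k, m = 2 * k + 1 := ⟨m / 2, by omega⟩
  rw [pow_succ, map_mul, chi_pow_even t (by omega), one_mul]

lemma chi_inv (t : Fˣ) : quadraticChar F ((t⁻¹ : Fˣ) : F) = quadraticChar F (t : F) := by
  have h : quadraticChar F ((t⁻¹ : Fˣ) : F) * quadraticChar F (t : F) = 1 := by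
    rw [← map_mul]; simp
  have h2 := chi_unit_sq t
  calc _ = quadraticChar F ((t⁻¹ : Fˣ) : F) * quadraticChar F (t : F) * quadraticChar F (t : F) := by
        rw [mul_assoc, h2, mul_one]
    _ = _ := by rw [h, one_mul]

lemma chi_term (t : Fˣ) {d : ℕ} (hd : d % 2 = 1) :
    quadraticChar F ((t : F) ^ d + ((t⁻¹ : Fˣ) : F) ^ d) =
      quadraticChar F (t : F) * quadraticChar F (1 + (t : F) ^ (2 * d)) := by
  have : (t : F) ^ d + ((t⁻¹ : Fˣ) : F) ^ d =
      ((t⁻¹ : Fˣ) : F) ^ d * (1 + (t : F) ^ (2 * d)) := by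
    have h : ((t⁻¹ : Fˣ) : F) ^ d * (t : F) ^ d = 1 := by rw [← mul_pow]; simp
    rw [two_mul, pow_add]
    linear_combination (-(t : F) ^ d) * h
  rw [this, map_mul, chi_pow_odd _ hd, chi_inv]

lemma sum_units_chi (hF : ringChar F ≠ 2) : ∑ t : Fˣ, quadraticChar F (t : F) = 0 := by
  have h := quadraticChar_sum_zero hF
  rw [Fintype.sum_eq_add_sum_compl 0, quadraticChar_zero, zero_add] at h
  rw [← h]
  symm
  refine Finset.sum_bij' (fun a ha => Units.mk0 a (by simpa using ha)) (fun t _ => (t : F)) ?_ ?_ ?_ ?_ ?_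
  all_goals simp

lemma sum_units {M : Type*} [AddCommGroup M] (g : F → M) : ∑ t : Fˣ, g t = ∑ x, g x - g 0 := by
  rw [Fintype.sum_eq_add_sum_compl (0 : F) g, add_sub_cancel_left]
  symm
  refine Finset.sum_bij' (fun a ha => Units.mk0 a (by simpa using ha)) (fun t _ => (t : F)) ?_ ?_ ?_ ?_ ?_
  all_goals simp

variable {q : ℕ}

lemma half_card (hQ : Fintype.card F = q ^ 2) (hq : q % 2 = 1) :
    Fintype.card F / 2 = (q - 1) * ((q + 1) / 2) := by
  obtain ⟨k, rfl⟩ : ∃ k, q = 2 * k + 1 := ⟨q / 2, by omega⟩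
  rw [hQ, show 2 * k + 1 - 1 = 2 * k by omega, show (2 * k + 1 + 1) / 2 = k + 1 by omega,
    show (2 * k + 1) ^ 2 = 1 + 2 * (2 * k * (k + 1)) by ring]
  omega

lemma card_sub_one (hQ : Fintype.card F = q ^ 2) :
    Fintype.card F - 1 = (q - 1) * (q + 1) := by
  rw [hQ, mul_comm, ← Nat.sq_sub_sq, one_pow]

lemma chi_sub (hQ : Fintype.card F = q ^ 2) (hq : q % 2 = 1) (hF : ringChar F ≠ 2) {b : Fˣ}
    (hb : b ^ (q - 1) = 1) : quadraticChar F (b : F) = 1 := by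
  apply chi_one_of_pow _ hF b.ne_zero
  rw [half_card hQ hq, pow_mul, ← Units.val_pow_eq_pow_val, hb, Units.val_one, one_pow]

lemma sum_K0 {M : Type*} [AddCommGroup M] (hq : 1 < q) (g : F → M) :
    ∑ b ∈ Finset.univ.filter (fun b : F => b ^ q = b), g b =
      g 0 + ∑ b ∈ Finset.univ.filter (fun b : Fˣ => b ^ (q - 1) = 1), g b := by
  rw [Finset.sum_filter, Finset.sum_filter]
  have := sum_units (fun b : F => if b ^ q = b then g b else 0)
  simp only [zero_pow (show q ≠ 0 by omega), if_true] at this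
  rw [← sub_eq_iff_eq_add', ← this]
  refine Finset.sum_congr rfl fun t _ => ?_
  have hiff : (t : F) ^ q = t ↔ t ^ (q - 1) = 1 := by
    rw [Units.ext_iff, Units.val_pow_eq_pow_val, Units.val_one]
    conv_lhs => rw [show q = q - 1 + 1 by omega, pow_succ]
    exact mul_eq_right₀ t.ne_zero
  simp only [hiff]

lemma h_sum (hQ : Fintype.card F = q ^ 2) (hq : q % 2 = 1) (hq1 : 1 < q) (hF : ringChar F ≠ 2)
    (hfrob : ∀ x y : F, (x + y) ^ q = x ^ q + y ^ q) (w : Fˣ) :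
    ∑ b ∈ Finset.univ.filter (fun b : Fˣ => b ^ (q - 1) = 1), quadraticChar F (1 + b * w) =
      if w ^ (q - 1) = 1 then (q : ℤ) - 2 else - 1 - quadraticChar F (w : F) := by
  have hcK : (Finset.univ.filter (fun b : Fˣ => b ^ (q - 1) = 1)).card = q - 1 :=
    card_pow_eq (by rw [card_sub_one hQ]; exact dvd_mul_right _ _) (by omega)
  have hcK0 : (Finset.univ.filter (fun b : F => b ^ q = b)).card = q := by
    have := sum_K0 (F := F) hq1 (fun _ => (1 : ℤ))
    simp only [Finset.sum_const, hcK, smul_eq_mul, nsmul_eq_mul] at this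
    push_cast [Nat.cast_sub hq1.le] at this
    have h2 : ((Finset.univ.filter (fun b : F => b ^ q = b)).card : ℤ) = q := by linarith
    exact_mod_cast h2
  have hq' : q = q - 1 + 1 := by omega
  have hneg : ∀ x : F, (-x) ^ q = - x ^ q := fun x => Odd.neg_pow (Nat.odd_iff.mpr hq) x
  split_ifs with hw
  · skip
    have h1 : ∑ b ∈ Finset.univ.filter (fun b : Fˣ => b ^ (q - 1) = 1), quadraticChar F (1 + b * w)
        = ∑ b ∈ Finset.univ.filter (fun b : Fˣ => b ^ (q - 1) = 1), quadraticChar F (1 + b) := by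
      refine Finset.sum_bij' (fun b _ => b * w) (fun b _ => b * w⁻¹) ?_ ?_ ?_ ?_ ?_
      · intro b hb; simp only [Finset.mem_filter, Finset.mem_univ, true_and] at hb ⊢
        rw [mul_pow, hb, hw, one_mul]
      · intro b hb; simp only [Finset.mem_filter, Finset.mem_univ, true_and] at hb ⊢
        rw [mul_pow, hb, inv_pow, hw, one_mul, inv_one]
      · intros; simp
      · intros; simp
      · intros; simp
    have h2 : ∀ b ∈ Finset.univ.filter (fun b : Fˣ => b ^ (q - 1) = 1),
        quadraticChar F (1 + b) = 1 - if b = -1 then 1 else 0 := by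
      intro b hb
      simp only [Finset.mem_filter, Finset.mem_univ, true_and] at hb
      split_ifs with h
      · subst h; simp
      · have hne : (1 : F) + b ≠ 0 := by
          intro h'; apply h; ext; push_cast; linear_combination h'
        rw [sub_zero]
        have hbq : (b : F) ^ q = b := by
          rw [hq', pow_succ, ← Units.val_pow_eq_pow_val, hb, Units.val_one, one_mul]
        refine chi_sub (b := Units.mk0 (1 + (b : F)) hne) hQ hq hF ?_
        ext
        push_cast
        rw [Units.val_mk0]
        apply mul_right_cancel₀ hne
        rw [← pow_succ, ← hq', hfrob, hbq, one_pow, one_mul]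
    rw [h1, Finset.sum_congr rfl h2, Finset.sum_sub_distrib, Finset.sum_const, hcK,
      Finset.sum_ite_eq', if_pos]
    · simp; push_cast [Nat.cast_sub hq1.le]; ring
    · simp only [Finset.mem_filter, Finset.mem_univ, true_and]
      exact Even.neg_one_pow (Nat.even_iff.mpr (by omega))
  · have hwq : (w : F) ^ q ≠ w := by
      intro h; apply hw; ext; push_cast
      apply mul_right_cancel₀ w.ne_zero
      rw [← pow_succ, ← hq', h, one_mul]
    have hbij : ∑ z ∈ Finset.univ.filter (fun b : F => b ^ q = b) ×ˢ
        Finset.univ.filter (fun b : F => b ^ q = b), quadraticChar F (z.1 + z.2 * w) =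
        ∑ x : F, quadraticChar F x := by
      have hinj : Set.InjOn (fun z : F × F => z.1 + z.2 * (w : F))
          ((Finset.univ.filter (fun b : F => b ^ q = b) ×ˢ
        Finset.univ.filter (fun b : F => b ^ q = b) : Finset (F × F)) : Set (F × F)) := by
        rintro ⟨a, b⟩ h1 ⟨c, d⟩ h2 h
        simp only [Finset.coe_product, Set.mem_prod, Finset.coe_filter, Finset.mem_univ, true_and,
          Set.mem_ofPred_eq] at h1 h2 h
        have hbd : b = d := by
          by_contra hbd
          have hne : b - d ≠ 0 := sub_ne_zero.mpr hbd
          have e1 : (b - d) * w = c - a := by linear_combination h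
          have e2 : (b - d) ^ q = b - d := by
            rw [sub_eq_add_neg, hfrob, hneg, h1.2, h2.2]
          have e3 : (c - a) ^ q = c - a := by
            rw [sub_eq_add_neg, hfrob, hneg, h1.1, h2.1]
          apply hwq
          apply mul_left_cancel₀ hne
          rw [e1, ← e3, ← e1, mul_pow, e2]
        subst hbd
        simp at h
        rw [h]
      refine Finset.sum_nbij (fun z : F × F => z.1 + z.2 * (w : F)) (by simp) hinj ?_ (by simp)
      refine Finset.surjOn_of_injOn_of_card_le _ (by simp) hinj ?_
      rw [Finset.card_product, hcK0, Finset.card_univ, hQ, sq]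
    rw [quadraticChar_sum_zero hF, Finset.sum_product, sum_K0 hq1] at hbij
    simp_rw [sum_K0 hq1] at hbij
    set S := ∑ b ∈ Finset.univ.filter (fun b : Fˣ => b ^ (q - 1) = 1), quadraticChar F (1 + b * w)
      with hS
    have h3 : ∀ c ∈ Finset.univ.filter (fun b : Fˣ => b ^ (q - 1) = 1),
        (quadraticChar F ((c : F) + 0 * w) +
          ∑ b ∈ Finset.univ.filter (fun b : Fˣ => b ^ (q - 1) = 1), quadraticChar F (c + b * w))
         = 1 + S := by
      intro c hc
      simp only [Finset.mem_filter, Finset.mem_univ, true_and] at hc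
      rw [zero_mul, add_zero, chi_sub hQ hq hF hc, hS]
      congr 1
      refine Finset.sum_bij' (fun b _ => b * c⁻¹) (fun b _ => b * c) ?_ ?_ ?_ ?_ ?_
      · intro b hb; simp only [Finset.mem_filter, Finset.mem_univ, true_and] at hb ⊢
        rw [mul_pow, hb, inv_pow, hc, one_mul, inv_one]
      · intro b hb; simp only [Finset.mem_filter, Finset.mem_univ, true_and] at hb ⊢
        rw [mul_pow, hb, hc, one_mul]
      · intros; simp
      · intros; simp
      · intro b hb
        have : (c : F) + b * w = c * (1 + ((b * c⁻¹ : Fˣ) : F) * w) := by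
          push_cast; field_simp
        rw [this, map_mul, chi_sub hQ hq hF hc, one_mul]
    have h4 : ∀ c ∈ Finset.univ.filter (fun b : Fˣ => b ^ (q - 1) = 1),
        quadraticChar F (0 + (c : F) * w) = quadraticChar F (w : F) := by
      intro c hc
      simp only [Finset.mem_filter, Finset.mem_univ, true_and] at hc
      rw [zero_add, map_mul, chi_sub hQ hq hF hc, one_mul]
    rw [Finset.sum_congr rfl h3, Finset.sum_congr rfl h4, Finset.sum_const, Finset.sum_const, hcK,
      zero_mul, add_zero, quadraticChar_zero, zero_add, ← smul_add, nsmul_eq_mul] at hbij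
    have : ((q - 1 : ℕ) : ℤ) ≠ 0 := by
      have : q - 1 ≠ 0 := by omega
      exact_mod_cast this
    have := (mul_eq_zero.mp hbij).resolve_left this
    linarith

lemma caseA (hQ : Fintype.card F = q ^ 2) (hq1 : 1 < q) (hF : ringChar F ≠ 2)
    (hfrob : ∀ x y : F, (x + y) ^ q = x ^ q + y ^ q) {d : ℕ} (hd : d % 2 = 1)
    (hdq : 4 * d ∣ q + 1) :
    ∑ t : Fˣ, quadraticChar F ((t : F) ^ d + ((t⁻¹ : Fˣ) : F) ^ d) = 2 * d * q := by
  obtain ⟨m, hm⟩ := hdq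
  have hq : q % 2 = 1 := by
    have : q + 1 = 4 * (d * m) := by rw [hm]; ring
    omega
  simp_rw [chi_term _ hd]
  set T := ∑ t : Fˣ, quadraticChar F (t : F) * quadraticChar F (1 + (t : F) ^ (2 * d)) with hT
  have hcK : (Finset.univ.filter (fun b : Fˣ => b ^ (q - 1) = 1)).card = q - 1 :=
    card_pow_eq (by rw [card_sub_one hQ]; exact dvd_mul_right _ _) (by omega)
  have hroot : ∀ b : Fˣ, b ^ (q - 1) = 1 → ∃ e : Fˣ, e ^ (2 * d) = b ∧ quadraticChar F (e : F) = 1 := by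
    intro b hb
    obtain ⟨g, hg⟩ := IsCyclic.exists_zpow_surjective (G := Fˣ)
    obtain ⟨j, hj⟩ := hg b
    simp only at hj
    have ho : orderOf g = (q - 1) * (q + 1) := by
      rw [orderOf_eq_card_of_forall_mem_zpowers (fun x => by
        obtain ⟨k, hk⟩ := hg x
        exact ⟨k, hk⟩), Nat.card_eq_fintype_card, Fintype.card_units, card_sub_one hQ]
    have h1 : g ^ (((q - 1 : ℕ) : ℤ) * j) = 1 := by
      rw [mul_comm, zpow_mul, hj, zpow_natCast, hb]
    rw [← orderOf_dvd_iff_zpow_eq_one, ho] at h1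
    push_cast at h1
    have hq0 : ((q - 1 : ℕ) : ℤ) ≠ 0 := by
      have : q - 1 ≠ 0 := by omega
      exact_mod_cast this
    obtain ⟨i, hi⟩ := Int.dvd_of_mul_dvd_mul_left hq0 h1
    refine ⟨(g ^ ((m : ℤ) * i)) ^ 2, ?_, ?_⟩
    · have hm' : (q : ℤ) + 1 = 4 * d * m := by exact_mod_cast hm
      rw [← hj, hi, hm', ← zpow_natCast, ← zpow_natCast, ← zpow_mul, ← zpow_mul]
      congr 1; push_cast; ring
    · rw [Units.val_pow_eq_pow_val]; exact chi_pow_even _ (by norm_num)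
  have h1 : ∀ b ∈ Finset.univ.filter (fun b : Fˣ => b ^ (q - 1) = 1),
      ∑ t : Fˣ, quadraticChar F (t : F) * quadraticChar F (1 + b * ((t ^ (2 * d) : Fˣ) : F)) = T := by
    intro b hb
    obtain ⟨e, he, hχ⟩ := hroot b (by simpa using hb)
    rw [hT]
    conv_rhs => rw [← Equiv.sum_comp (Equiv.mulLeft e)]
    refine Finset.sum_congr rfl fun t _ => ?_
    simp only [Equiv.coe_mulLeft, Units.val_mul, map_mul, hχ, one_mul, mul_pow]
    rw [← he]; push_cast; ring_nf
  have h2 := Finset.sum_congr rfl h1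
  rw [Finset.sum_const, hcK, Finset.sum_comm] at h2
  simp_rw [← Finset.mul_sum, h_sum hQ hq hq1 hF hfrob] at h2
  have h3 : ∀ t : Fˣ, quadraticChar F (t : F) * (if (t ^ (2 * d)) ^ (q - 1) = 1 then (q : ℤ) - 2
      else -1 - quadraticChar F ((t ^ (2 * d) : Fˣ) : F)) =
      (-2) * quadraticChar F (t : F) + if t ^ (2 * d * (q - 1)) = 1 then (q : ℤ) else 0 := by
    intro t
    rw [Units.val_pow_eq_pow_val, chi_pow_even t (by omega), ← pow_mul]
    split_ifs with h
    · have : quadraticChar F (t : F) = 1 := by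
        apply chi_one_of_pow _ hF t.ne_zero
        rw [half_card hQ hq, hm, show 4 * d * m / 2 = 2 * d * m by
          rw [show 4 * d * m = 2 * (2 * d * m) by ring]; omega,
          show (q - 1) * (2 * d * m) = 2 * d * (q - 1) * m by ring, pow_mul,
          ← Units.val_pow_eq_pow_val, h, Units.val_one, one_pow]
      rw [this]; ring
    · ring
  simp_rw [h3] at h2
  rw [Finset.sum_add_distrib, ← Finset.mul_sum, sum_units_chi hF, ← Finset.sum_filter,
    Finset.sum_const, card_pow_eq] at h2
  · have hq0 : ((q - 1 : ℕ) : ℤ) ≠ 0 := by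
      have : q - 1 ≠ 0 := by omega
      exact_mod_cast this
    apply mul_left_cancel₀ hq0
    simp only [nsmul_eq_mul] at h2
    rw [← h2]; push_cast; ring
  · rw [card_sub_one hQ, hm]; exact ⟨2 * m, by ring⟩
  · have : d ≠ 0 := by omega
    have : q - 1 ≠ 0 := by omega
    positivity
end basics

section gauss
variable {F : Type*} [Field F] [Fintype F] [DecidableEq F] {q : ℕ}

lemma exists_addChar (p : ℕ) [Fact p.Prime] [CharP F p] (n : ℕ) :
    ∃ ψ : AddChar F ℂ, ψ.IsPrimitive ∧ ∀ x, ψ (x ^ (p ^ n)) = ψ x := by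
  have hpc : ringChar F = p := ringChar.eq_iff.mpr inferInstance
  subst hpc
  let _ : Algebra (ZMod (ringChar F)) F := ZMod.algebra _ _
  set p := ringChar F with hp
  have hζ := Complex.isPrimitiveRoot_exp p (NeZero.ne p)
  set ψ₀ := AddChar.zmodChar p ((IsPrimitiveRoot.iff_def _ p).mp hζ).left with hψ₀
  have hprim : ψ₀.IsPrimitive := AddChar.zmodChar_primitive_of_primitive_root p hζ
  refine ⟨ψ₀.compAddMonoidHom (Algebra.trace (ZMod p) F).toAddMonoidHom, ?_, ?_⟩
  · apply AddChar.IsPrimitive.of_ne_one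
    obtain ⟨a, ha⟩ := FiniteField.trace_to_zmod_nondegenerate F (one_ne_zero (α := F))
    rw [one_mul] at ha
    exact AddChar.ne_one_iff.2 ⟨a, fun hf => ha <|
      (hprim.zmod_char_eq_one_iff p <| Algebra.trace (ZMod p) F a).mp hf⟩
  · have key : ∀ x : F, Algebra.trace (ZMod p) F (x ^ p) = Algebra.trace (ZMod p) F x := by
      intro x
      have := Algebra.trace_eq_of_algEquiv (FiniteField.frobeniusAlgEquivOfAlgebraic (ZMod p) F) x
      simpa [ZMod.card] using this
    intro x
    simp only [AddChar.compAddMonoidHom_apply]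
    congr 1
    show Algebra.trace (ZMod p) F _ = Algebra.trace (ZMod p) F _
    induction n with
    | zero => simp
    | succ n ih => rw [pow_succ, pow_mul, key, ih]

lemma gauss_shift (hF : ringChar F ≠ 2) (ψ : AddChar F ℂ) (z : F) :
    ∑ a : Fˣ, (quadraticChar F (a : F) : ℂ) * ψ (a * z) =
      quadraticChar F z * ∑ a : Fˣ, (quadraticChar F (a : F) : ℂ) * ψ a := by
  by_cases hz : z = 0
  · subst hz
    simp only [mul_zero, AddChar.map_zero_eq_one, mul_one, quadraticChar_zero, Int.cast_zero,
      zero_mul]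
    exact_mod_cast sum_units_chi hF
  · obtain ⟨u, rfl⟩ : ∃ u : Fˣ, (u : F) = z := ⟨Units.mk0 z hz, rfl⟩
    rw [Finset.mul_sum, ← Equiv.sum_comp (Equiv.mulRight u) (fun a : Fˣ =>
      (quadraticChar F (u : F) : ℂ) * ((quadraticChar F (a : F) : ℂ) * ψ a))]
    refine Finset.sum_congr rfl fun a _ => ?_
    simp only [Equiv.coe_mulRight, Units.val_mul, map_mul]
    have : (quadraticChar F (u : F) : ℂ) * quadraticChar F (u : F) = 1 := by
      exact_mod_cast chi_unit_sq u
    push_cast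
    linear_combination (-(quadraticChar F (a : F) : ℂ) * ψ (a * u)) * this

lemma sum_psi (ψ : AddChar F ℂ) (hψ : ψ.IsPrimitive) (z : F) :
    ∑ y : Fˣ, ψ (y * z) = (if z = 0 then (Fintype.card F : ℂ) else 0) - 1 := by
  rw [sum_units (fun y : F => ψ (y * z)), AddChar.sum_mulShift z hψ, zero_mul,
    AddChar.map_zero_eq_one]
  split_ifs <;> simp

lemma caseB (hQ : Fintype.card F = q ^ 2) (hF : ringChar F ≠ 2)
    (ψ : AddChar F ℂ) (hψ : ψ.IsPrimitive) (hψq : ∀ x, ψ (x ^ q) = ψ x)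
    {d : ℕ} (hd : d % 2 = 1) (hq4 : q % 4 = 3)
    (hdq : 2 * d ∣ q - 1) :
    ((∑ t : Fˣ, quadraticChar F ((t : F) ^ d + ((t⁻¹ : Fˣ) : F) ^ d) : ℤ) : ℂ) *
      (∑ a : Fˣ, (quadraticChar F (a : F) : ℂ) * ψ a) = 2 * d * q ^ 2 := by
  obtain ⟨m, hm⟩ := hdq
  obtain ⟨k, hk⟩ : ∃ k, q + 1 = 2 * k := ⟨(q + 1) / 2, by omega⟩
  have hm2 : m % 2 = 1 := by
    rcases Nat.even_or_odd' m with ⟨c, rfl | rfl⟩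
    · have : q - 1 = 4 * (d * c) := by rw [hm]; ring
      omega
    · omega
  have hk2 : k % 2 = 0 := by omega
  have hqkm : d * m + k = q := by
    have : q - 1 = 2 * (d * m) := by rw [hm]; ring
    omega
  have hq2 : ∀ t : Fˣ, (t ^ q) ^ q = t := by
    intro t; ext; push_cast; rw [← pow_mul, ← sq, ← hQ, FiniteField.pow_card]
  let e : Fˣ × Fˣ → Fˣ × Fˣ := fun z => (z.2 ^ m * z.1 ^ k, z.2 * (z.1⁻¹) ^ d)
  have hinj : Function.Injective e := by
    rintro ⟨t, a⟩ ⟨s, b⟩ h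
    simp only [e, Prod.mk.injEq] at h
    obtain ⟨h1, h2⟩ := h
    have ht : t ^ q = s ^ q := by
      have h3 : (a * (t⁻¹) ^ d) ^ m = (b * (s⁻¹) ^ d) ^ m := by rw [h2]
      rw [← hqkm, pow_add, pow_add, pow_mul, pow_mul]
      have e1 : ∀ a t : Fˣ, (t ^ d) ^ m * t ^ k = (a ^ m * t ^ k) * ((a * (t⁻¹) ^ d) ^ m)⁻¹ := by
        intro a t
        rw [mul_pow, mul_inv, inv_pow, inv_pow, inv_inv]
        rw [mul_mul_mul_comm, mul_inv_cancel, one_mul, mul_comm]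
      rw [e1 a t, e1 b s, h1, h3]
    have hts : t = s := by rw [← hq2 t, ht, hq2]
    subst hts
    simpa using h2
  have hbij : Function.Bijective e := Finite.injective_iff_bijective.mp hinj
  rw [Int.cast_sum, Finset.sum_mul]
  simp_rw [← gauss_shift hF]
  calc ∑ t : Fˣ, ∑ a : Fˣ, (quadraticChar F (a : F) : ℂ) *
        ψ (a * ((t : F) ^ d + ((t⁻¹ : Fˣ) : F) ^ d))
      = ∑ z : Fˣ × Fˣ, (quadraticChar F ((e z).1 : F) : ℂ) *
        ψ ((e z).2 * (((e z).1 : F) ^ (2 * d) + 1)) := by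
        rw [Fintype.sum_prod_type]
        refine Finset.sum_congr rfl fun t _ => Finset.sum_congr rfl fun a _ => ?_
        simp only [e]
        congr 1
        · push_cast
          rw [map_mul, chi_pow_odd _ hm2, chi_pow_even _ hk2, mul_one]
        · rw [mul_add, mul_add, mul_one, AddChar.map_add_eq_mul, AddChar.map_add_eq_mul,
            ← hψq ((a : F) * (t : F) ^ d)]
          congr 1
          congr 1
          have h5 : (((a * (t⁻¹) ^ d) * (a ^ m * t ^ k) ^ (2 * d) : Fˣ)) = (a * t ^ d) ^ q := by
            have e1 : (a ^ m * t ^ k) ^ (2 * d) = a ^ (q - 1) * (t ^ d) ^ (q + 1) := by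
              rw [mul_pow, ← pow_mul, ← pow_mul, ← pow_mul, hm, hk]
              congr 2 <;> ring
            have e2 : (a * t ^ d) ^ q = a * a ^ (q - 1) * (t ^ d) ^ q := by
              rw [mul_pow, ← pow_succ', show q - 1 + 1 = q by omega]
            rw [e1, e2, pow_succ (t ^ d), inv_pow]
            rw [mul_mul_mul_comm]
            congr 1
            rw [mul_comm, mul_assoc, mul_inv_cancel, mul_one]
          have := congrArg (fun u : Fˣ => (u : F)) h5
          push_cast at this ⊢
          exact this.symm
    _ = ∑ z : Fˣ × Fˣ, (quadraticChar F (z.1 : F) : ℂ) *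
        ψ (z.2 * ((z.1 : F) ^ (2 * d) + 1)) :=
        Function.Bijective.sum_comp hbij (fun z : Fˣ × Fˣ => (quadraticChar F (z.1 : F) : ℂ) *
          ψ (z.2 * ((z.1 : F) ^ (2 * d) + 1)))
    _ = ∑ s : Fˣ, ((if (s : F) ^ (2 * d) = -1 then (q : ℂ) ^ 2 else 0)
          - (quadraticChar F (s : F) : ℂ)) := by
        rw [Fintype.sum_prod_type]
        refine Finset.sum_congr rfl fun s _ => ?_
        simp only
        rw [← Finset.mul_sum, sum_psi ψ hψ, hQ]
        simp only [eq_neg_iff_add_eq_zero]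
        split_ifs with h
        · have h' : (s : F) ^ (2 * d) = -1 := eq_neg_of_add_eq_zero_left h
          have : quadraticChar F (s : F) = 1 := by
            rw [← chi_pow_odd s hd]
            have hne : (s : F) ^ d ≠ 0 := pow_ne_zero _ s.ne_zero
            apply chi_one_of_pow _ hF hne
            obtain ⟨c, hc⟩ : ∃ c, (q + 1) / 2 = 2 * c := ⟨(q + 1) / 4, by omega⟩
            obtain ⟨c', hc'⟩ : ∃ c', q - 1 = 2 * c' := ⟨(q - 1) / 2, by omega⟩
            rw [half_card hQ (by omega), hc, hc', ← pow_mul,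
              show d * (2 * c' * (2 * c)) = 2 * d * (2 * (c * c')) by ring, pow_mul, h', pow_mul]
            norm_num
          rw [this]; push_cast; ring
        · ring
    _ = 2 * d * q ^ 2 := by
        have hd4 : 4 * d ∣ Fintype.card F - 1 := by
          rw [card_sub_one hQ, hm, hk]; exact ⟨m * k, by ring⟩
        rw [Finset.sum_sub_distrib, ← Finset.sum_filter, Finset.sum_const,
          card_neg_one hF hd4 (by omega)]
        have : ∑ s : Fˣ, (quadraticChar F (s : F) : ℂ) = 0 := by exact_mod_cast sum_units_chi hF
        rw [this]
        simp

end gauss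

section perm
variable {F : Type*} [Field F] [Fintype F] [DecidableEq F] {q : ℕ}

lemma dick_hom {A B : Type*} [CommRing A] [CommRing B] (f : A →+* B) (d : ℕ) (x : A) :
    f ((dickson 1 (1 : A) d).eval x) = (dickson 1 (1 : B) d).eval (f x) := by
  rw [← Polynomial.eval_map_apply, map_dickson, map_one]

/-- The element t is a parameter for x. -/
def Par (t : AlgebraicClosure F) (x : F) : Prop :=
  t ≠ 0 ∧ t + t⁻¹ = algebraMap F (AlgebraicClosure F) x

lemma exists_par (x : F) : ∃ t, Par t x := by
  let ι := algebraMap F (AlgebraicClosure F)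
  have hdeg : (X ^ 2 - C (ι x) * X + 1 : (AlgebraicClosure F)[X]).degree = 2 := by
    compute_degree!
  obtain ⟨t, ht⟩ := IsAlgClosed.exists_root (X ^ 2 - C (ι x) * X + 1 : (AlgebraicClosure F)[X])
    (by rw [hdeg]; norm_num)
  simp [IsRoot] at ht
  have h0 : t ≠ 0 := by rintro rfl; simp at ht
  refine ⟨t, h0, ?_⟩
  field_simp
  linear_combination ht

lemma par_dick {t : AlgebraicClosure F} {x : F} (h : Par t x) (d : ℕ) :
    Par (t ^ d) ((dickson 1 (1 : F) d).eval x) := by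
  refine ⟨pow_ne_zero _ h.1, ?_⟩
  rw [dick_hom, ← h.2, dickson_one_one_eval_add_inv _ _ (mul_inv_cancel₀ h.1), inv_pow]

lemma par_inj {s t : AlgebraicClosure F} {x : F} (hs : Par s x) (ht : Par t x) :
    s = t ∨ s = t⁻¹ := by
  have h := hs.2.trans ht.2.symm
  have hs0 := hs.1
  have ht0 := ht.1
  have : (s - t) * (s - t⁻¹) = 0 := by
    field_simp at h ⊢
    linear_combination h
  rcases mul_eq_zero.mp this with h | h
  · left; exact sub_eq_zero.mp h
  · right; exact sub_eq_zero.mp h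

lemma par_unique {t : AlgebraicClosure F} {x y : F} (hx : Par t x) (hy : Par t y) : x = y :=
  (algebraMap F (AlgebraicClosure F)).injective (hx.2.symm.trans hy.2)

lemma par_inv {t : AlgebraicClosure F} {x : F} (hx : Par t x) : Par t⁻¹ x :=
  ⟨inv_ne_zero hx.1, by rw [inv_inv, add_comm]; exact hx.2⟩

lemma par_neg {t : AlgebraicClosure F} {x : F} (hx : Par t x) : Par (-t) (-x) :=
  ⟨neg_ne_zero.mpr hx.1, by rw [inv_neg, map_neg, ← hx.2]; ring⟩

lemma par_sq {t : AlgebraicClosure F} {x : F} (hx : Par t x) :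
    (t - t⁻¹) ^ 2 = algebraMap F (AlgebraicClosure F) (x ^ 2 - 4) := by
  have := mul_inv_cancel₀ hx.1
  simp only [map_sub, map_pow, ← hx.2, map_ofNat]
  linear_combination (-4) * this

lemma two_ne_L (hF : ringChar F ≠ 2) : (2 : AlgebraicClosure F) ≠ 0 := by
  have := (algebraMap F (AlgebraicClosure F)).injective.ne (two_ne' hF)
  rwa [map_ofNat, map_zero] at this

lemma par_key (hF : ringChar F ≠ 2) {t : AlgebraicClosure F} {x : F} (hx : Par t x) :
    2 * t ^ (Fintype.card F) =
      t + t⁻¹ + ((quadraticChar F (x ^ 2 - 4) : ℤ) : AlgebraicClosure F) * (t - t⁻¹) := by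
  have hodd := FiniteField.odd_card_of_char_ne_two hF
  have h1 : (t + t⁻¹) ^ Fintype.card F = t + t⁻¹ := by
    rw [hx.2, ← map_pow, FiniteField.pow_card]
  have h2 : (t - t⁻¹) ^ Fintype.card F =
      ((quadraticChar F (x ^ 2 - 4) : ℤ) : AlgebraicClosure F) * (t - t⁻¹) := by
    have e : Fintype.card F = 2 * (Fintype.card F / 2) + 1 := by omega
    conv_lhs => rw [e, pow_succ, pow_mul, par_sq hx, ← map_pow,
      ← quadraticChar_eq_pow_of_char_ne_two' hF]
    simp
  have h3 := map_add (FiniteField.frobeniusAlgHom F (AlgebraicClosure F)) t t⁻¹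
  have h4 := map_sub (FiniteField.frobeniusAlgHom F (AlgebraicClosure F)) t t⁻¹
  simp only [FiniteField.coe_frobeniusAlgHom] at h3 h4
  rw [h1] at h3
  rw [h2] at h4
  linear_combination -h3 - h4

lemma par_one (hF : ringChar F ≠ 2) {t : AlgebraicClosure F} {x : F} (hx : Par t x)
    (h : quadraticChar F (x ^ 2 - 4) = 1) : t ^ (Fintype.card F) = t := by
  have := par_key hF hx
  rw [h] at this
  apply mul_left_cancel₀ (two_ne_L hF)
  push_cast at this
  linear_combination this

lemma par_ne_one (hF : ringChar F ≠ 2) {t : AlgebraicClosure F} {x : F} (hx : Par t x)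
    (h : quadraticChar F (x ^ 2 - 4) ≠ 1) : t ^ (Fintype.card F + 1) = 1 := by
  have key := par_key hF hx
  rw [pow_succ]
  have : t ^ (Fintype.card F) = t⁻¹ := by
    apply mul_left_cancel₀ (two_ne_L hF)
    by_cases h0 : x ^ 2 - 4 = 0
    · have h1 := par_sq hx
      rw [h0, map_zero] at h1
      have h2 : t - t⁻¹ = 0 := pow_eq_zero_iff (two_ne_zero) |>.mp h1
      rw [key, h2]; linear_combination h2
    · rw [(quadraticChar_dichotomy h0).resolve_left h] at key
      rw [key]; push_cast; ring
  rw [this, inv_mul_cancel₀ hx.1]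

lemma par_zero_iff {t : AlgebraicClosure F} {x : F} (hx : Par t x) :
    x ^ 2 - 4 = 0 ↔ t ^ 2 = 1 := by
  have h := par_sq hx
  have ht := hx.1
  constructor
  · intro h0
    rw [h0, map_zero] at h
    have h2 : t - t⁻¹ = 0 := pow_eq_zero_iff (two_ne_zero) |>.mp h
    field_simp at h2
    linear_combination h2
  · intro h0
    have h2 : t - t⁻¹ = 0 := by field_simp; linear_combination h0
    rw [h2] at h
    apply (algebraMap F (AlgebraicClosure F)).injective
    rw [← h]; simp

lemma par_ne_one' (hF : ringChar F ≠ 2) {t : AlgebraicClosure F} {x : F} (hx : Par t x)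
    (h : t ^ (Fintype.card F + 1) = 1) : quadraticChar F (x ^ 2 - 4) ≠ 1 := by
  intro h1
  have h2 := par_one hF hx h1
  rw [pow_succ, h2, ← sq, ← par_zero_iff hx] at h
  rw [h, quadraticChar_zero] at h1
  exact zero_ne_one h1

lemma pow_inj_of_coprime {s t : AlgebraicClosure F} {l M : ℕ} (hc : l.Coprime M)
    (hs0 : s ≠ 0) (hs : s ^ M = 1) (ht : t ^ M = 1) (h : t ^ l = s ^ l) : t = s := by
  have h1 : (t / s) ^ M = 1 := by rw [div_pow, hs, ht, div_one]
  have h2 : (t / s) ^ l = 1 := by rw [div_pow, h, div_self (pow_ne_zero _ hs0)]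
  have h3 : orderOf (t / s) ∣ Nat.gcd l M :=
    Nat.dvd_gcd (orderOf_dvd_of_pow_eq_one h2) (orderOf_dvd_of_pow_eq_one h1)
  rw [hc.gcd_eq_one, Nat.dvd_one, orderOf_eq_one_iff] at h3
  exact (div_eq_one_iff_eq hs0).mp h3

lemma dick_inj {s t : AlgebraicClosure F} {x y : F} (hx : Par s x) (hy : Par t y) {l M : ℕ}
    (hc : l.Coprime M) (hs : s ^ M = 1) (ht : t ^ M = 1)
    (h : (dickson 1 (1 : F) l).eval x = (dickson 1 (1 : F) l).eval y) : x = y := by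
  have h1 := par_dick hx l
  have h2 := par_dick hy l
  rw [h] at h1
  rcases par_inj h1 h2 with h3 | h3
  · have := pow_inj_of_coprime hc hy.1 ht hs h3
    subst this
    exact par_unique hx hy
  · rw [← inv_pow] at h3
    have := pow_inj_of_coprime hc (inv_ne_zero hy.1) (by rw [inv_pow, ht, inv_one]) hs h3
    subst this
    exact par_unique hx (par_inv hy)

lemma par_order (hF : ringChar F ≠ 2) {t : AlgebraicClosure F} {x : F} (hx : Par t x) :
    t ^ (Fintype.card F ^ 2 - 1) = 1 := by
  have : Fintype.card F ^ 2 - 1 = (Fintype.card F + 1) * (Fintype.card F - 1) := by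
    rw [← Nat.sq_sub_sq, one_pow]
  rw [this]
  by_cases h : quadraticChar F (x ^ 2 - 4) = 1
  · have h1 := par_one hF hx h
    have : t ^ (Fintype.card F - 1) = 1 := by
      apply mul_right_cancel₀ hx.1
      rw [← pow_succ, Nat.sub_add_cancel Fintype.card_pos, h1, one_mul]
    rw [mul_comm, pow_mul, this, one_pow]
  · rw [pow_mul, par_ne_one hF hx h, one_pow]

lemma perm_sum (hF : ringChar F ≠ 2) {l : ℕ} (hc : l.Coprime (Fintype.card F ^ 2 - 1)) :
    ∑ x : F, quadraticChar F ((dickson 1 (1 : F) l).eval x) = 0 := by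
  have hinj : Function.Injective (fun x : F => (dickson 1 (1 : F) l).eval x) := by
    intro x y h
    obtain ⟨s, hs⟩ := exists_par x
    obtain ⟨t, ht⟩ := exists_par y
    exact dick_inj hs ht hc (par_order hF hs) (par_order hF ht) h
  rw [Function.Bijective.sum_comp (Finite.injective_iff_bijective.mp hinj)
    (fun x => quadraticChar F x), quadraticChar_sum_zero hF]

lemma V_sum (hF : ringChar F ≠ 2) {l : ℕ} (hc : l.Coprime (Fintype.card F + 1)) :
    ∑ x : F, (1 - quadraticChar F (x ^ 2 - 4)) * quadraticChar F ((dickson 1 (1 : F) l).eval x) =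
      ∑ x : F, (1 - quadraticChar F (x ^ 2 - 4)) * quadraticChar F x := by
  have hres : ∀ g : F → ℤ, ∑ x : F, (1 - quadraticChar F (x ^ 2 - 4)) * g x =
      ∑ x ∈ Finset.univ.filter (fun x : F => quadraticChar F (x ^ 2 - 4) ≠ 1),
        (1 - quadraticChar F (x ^ 2 - 4)) * g x := by
    intro g
    rw [Finset.sum_filter]
    refine Finset.sum_congr rfl fun x _ => ?_
    split_ifs with h
    · rfl
    · rw [not_not.mp h]; ring
  rw [hres, hres]
  have hmaps : ∀ x ∈ Finset.univ.filter (fun x : F => quadraticChar F (x ^ 2 - 4) ≠ 1),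
      (dickson 1 (1 : F) l).eval x ∈
        Finset.univ.filter (fun x : F => quadraticChar F (x ^ 2 - 4) ≠ 1) := by
    intro x hx
    simp only [Finset.mem_filter, Finset.mem_univ, true_and] at hx ⊢
    obtain ⟨t, ht⟩ := exists_par x
    refine par_ne_one' hF (par_dick ht l) ?_
    rw [← pow_mul, mul_comm, pow_mul, par_ne_one hF ht hx, one_pow]
  have hinj : Set.InjOn (fun x : F => (dickson 1 (1 : F) l).eval x)
      (Finset.univ.filter (fun x : F => quadraticChar F (x ^ 2 - 4) ≠ 1) : Finset F) := by
    intro x hx y hy h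
    simp only [Finset.coe_filter, Finset.mem_univ, true_and, Set.mem_ofPred_eq] at hx hy
    obtain ⟨s, hs⟩ := exists_par x
    obtain ⟨t, ht⟩ := exists_par y
    exact dick_inj hs ht hc (par_ne_one hF hs hx) (par_ne_one hF ht hy) h
  refine Finset.sum_nbij (fun x : F => (dickson 1 (1 : F) l).eval x) hmaps hinj ?_ ?_
  · exact Finset.surjOn_of_injOn_of_card_le _ hmaps hinj le_rfl
  · intro x hx
    have hx' := hmaps x hx
    simp only [Finset.mem_filter, Finset.mem_univ, true_and] at hx hx'
    obtain ⟨t, ht⟩ := exists_par x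
    have hz : x ^ 2 - 4 = 0 ↔ (dickson 1 (1 : F) l).eval x ^ 2 - 4 = 0 := by
      rw [par_zero_iff ht, par_zero_iff (par_dick ht l)]
      constructor
      · intro h; rw [← pow_mul, mul_comm, pow_mul, h, one_pow]
      · intro h
        refine pow_inj_of_coprime hc one_ne_zero (one_pow _) ?_ ?_
        · rw [← pow_mul, mul_comm, pow_mul, par_ne_one hF ht hx, one_pow]
        · rw [← pow_mul, mul_comm, pow_mul, h, one_pow]
    congr 2
    by_cases h0 : x ^ 2 - 4 = 0
    · rw [h0, hz.mp h0]
    · rw [(quadraticChar_dichotomy h0).resolve_left hx,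
        (quadraticChar_dichotomy (fun h => h0 (hz.mpr h))).resolve_left hx']

end perm

section mod8
variable {F : Type*} [Field F] [Fintype F] [DecidableEq F] {q : ℕ}

lemma dick_neg {l : ℕ} (hl : l % 2 = 1) (x : F) :
    (dickson 1 (1 : F) l).eval (-x) = -(dickson 1 (1 : F) l).eval x := by
  obtain ⟨t, ht⟩ := exists_par x
  have h1 := par_dick (par_neg ht) l
  have h2 := par_neg (par_dick ht l)
  rw [Odd.neg_pow (Nat.odd_iff.mpr hl)] at h1
  exact par_unique h1 h2

lemma four_dvd_card (X : Finset F) (σ : F → F) (hσ : ∀ x, σ (σ x) = x) (hσn : ∀ x, σ (-x) = -σ x)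
    (h1 : ∀ x ∈ X, -x ∈ X) (h2 : ∀ x ∈ X, σ x ∈ X) (h3 : ∀ x ∈ X, x ≠ -x)
    (h4 : ∀ x ∈ X, σ x ≠ x) (h5 : ∀ x ∈ X, σ x ≠ -x) : 4 ∣ X.card := by
  let g : F → Finset F := fun x => {x, -x, σ x, -σ x}
  rw [Finset.card_eq_sum_card_image g X]
  apply Finset.dvd_sum
  intro s hs
  obtain ⟨x, hx, rfl⟩ := Finset.mem_image.mp hs
  have hfib : X.filter (fun y => g y = g x) = g x := by
    ext y
    simp only [Finset.mem_filter]
    constructor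
    · rintro ⟨_, h⟩
      rw [← h]; simp [g]
    · intro hy
      simp only [g, Finset.mem_insert, Finset.mem_singleton] at hy
      rcases hy with rfl | rfl | rfl | rfl
      · exact ⟨hx, rfl⟩
      · refine ⟨h1 _ hx, ?_⟩
        ext z; simp only [g, Finset.mem_insert, Finset.mem_singleton, hσn, neg_neg]; tauto
      · refine ⟨h2 _ hx, ?_⟩
        ext z; simp only [g, Finset.mem_insert, Finset.mem_singleton, hσ]; tauto
      · refine ⟨h1 _ (h2 _ hx), ?_⟩
        ext z; simp only [g, Finset.mem_insert, Finset.mem_singleton, hσ, hσn, neg_neg]; tauto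
  rw [hfib]
  have hc : (g x).card = 4 := by
    have a1 := h3 x hx
    have a2 := h4 x hx
    have a3 := h5 x hx
    have a4 := h3 _ (h2 x hx)
    have a5 : x ≠ -σ x := fun h => a3 (by rw [h, neg_neg, ← h])
    have a6 : -x ≠ -σ x := fun h => a2 (neg_injective h).symm
    simp only [g]
    rw [Finset.card_insert_of_notMem, Finset.card_insert_of_notMem, Finset.card_insert_of_notMem,
      Finset.card_singleton]
    · simpa using a4
    · simp only [Finset.mem_insert, Finset.mem_singleton, not_or]; exact ⟨a3.symm, a6⟩
    · simp only [Finset.mem_insert, Finset.mem_singleton, not_or]; exact ⟨a1, a2.symm, a5⟩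
  rw [hc]

lemma root_par (hF : ringChar F ≠ 2) {l : ℕ} {t : AlgebraicClosure F} {x : F} (ht : Par t x)
    (hx : (dickson 1 (1 : F) l).eval x = 0) : t ^ (2 * l) = -1 := by
  have h := (par_dick ht l).2
  have h0 := (par_dick ht l).1
  rw [hx, map_zero] at h
  field_simp at h
  rw [mul_comm, pow_mul]
  linear_combination h

lemma card_roots (hF : ringChar F ≠ 2) {l : ℕ} (hl : 0 < l) (h4 : 4 * l ∣ Fintype.card F - 1) :
    (Finset.univ.filter fun x : F => (dickson 1 (1 : F) l).eval x = 0).card = l := by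
  have h := conv_sum hF (fun x => if (dickson 1 (1 : F) l).eval x = 0 then 1 else 0)
  simp only [dick_eval] at h
  have e1 : ∀ t : Fˣ, (t : F) ^ l + ((t⁻¹ : Fˣ) : F) ^ l = 0 ↔ (t : F) ^ (2 * l) = -1 := by
    intro t
    have h : ((t⁻¹ : Fˣ) : F) ^ l * (t : F) ^ l = 1 := by rw [← mul_pow]; simp
    rw [mul_comm, pow_mul]
    constructor
    · intro h'; linear_combination (t : F) ^ l * h' - h
    · intro h'; linear_combination (((t⁻¹ : Fˣ) : F) ^ l) * h' - ((t : F) ^ l) * h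
  simp only [e1] at h
  rw [← Finset.sum_filter, Finset.sum_const, card_neg_one hF h4 hl] at h
  have e2 : ∀ x : F, (1 + quadraticChar F (x ^ 2 - 4)) *
      (if (dickson 1 (1 : F) l).eval x = 0 then (1 : ℤ) else 0) =
      if (dickson 1 (1 : F) l).eval x = 0 then (2 : ℤ) else 0 := by
    intro x
    split_ifs with hx
    · obtain ⟨t, ht⟩ := exists_par x
      have h1 := root_par hF ht hx
      have : quadraticChar F (x ^ 2 - 4) = 1 := by
        by_contra hne
        have h2 := par_ne_one hF ht hne
        obtain ⟨c, hc⟩ := h4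
        have h3 : t ^ (Fintype.card F - 1) = 1 := by
          rw [hc, show 4 * l * c = 2 * l * (2 * c) by ring, pow_mul, h1, pow_mul]; norm_num
        have h5 : t ^ 2 = 1 := by
          rw [show Fintype.card F + 1 = Fintype.card F - 1 + 2 by
            have := Fintype.card_pos (α := F); omega, pow_add, h3, one_mul] at h2
          exact h2
        rw [pow_mul, h5, one_pow] at h1
        apply two_ne_L hF
        linear_combination h1
      rw [this]; norm_num
    · ring
  simp only [e2] at h
  rw [← Finset.sum_filter, Finset.sum_const] at h
  simp only [nsmul_eq_mul] at h
  push_cast at h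
  have h' : ((Finset.univ.filter fun x : F => (dickson 1 (1 : F) l).eval x = 0).card : ℤ) = l := by
    linarith
  exact_mod_cast h'

lemma mod8 (hQ : Fintype.card F = q ^ 2) (hF : ringChar F ≠ 2)
    (σ : F →+* F) (hσ : ∀ x, σ x = x ^ q) (hq8 : q % 8 = 1) (hq1 : 1 < q) {l : ℕ}
    (hl : l % 2 = 1) (h4 : 4 * l ∣ q - 1)
    (hL : ∀ a b : AlgebraicClosure F, (a + b) ^ q = a ^ q + b ^ q) :
    (8 : ℤ) ∣ ∑ x : F, quadraticChar F ((dickson 1 (1 : F) l).eval x) - (1 - l) := by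
  have hQ1 := card_sub_one hQ
  have h4' : 4 * l ∣ Fintype.card F - 1 := by rw [hQ1]; exact h4.trans (dvd_mul_right _ _)
  have hz := card_roots hF (by omega) h4'
  have hcK : (Finset.univ.filter (fun b : Fˣ => b ^ (q - 1) = 1)).card = q - 1 :=
    card_pow_eq (by rw [hQ1]; exact dvd_mul_right _ _) (by omega)
  have hcK0 : ((Finset.univ.filter (fun b : F => b ^ q = b)).card : ℤ) = q := by
    have := sum_K0 (F := F) hq1 (fun _ => (1 : ℤ))
    simp only [Finset.sum_const, hcK, nsmul_eq_mul] at this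
    push_cast [Nat.cast_sub hq1.le] at this
    linarith
  have hsub1 : q = q - 1 + 1 := by omega
  have hroot : ∀ x : F, (dickson 1 (1 : F) l).eval x = 0 → x ^ q = x := by
    intro x hx
    obtain ⟨t, ht⟩ := exists_par x
    have h1 := root_par hF ht hx
    obtain ⟨c, hc⟩ := h4
    have h3 : t ^ (q - 1) = 1 := by
      rw [hc, show 4 * l * c = 2 * l * (2 * c) by ring, pow_mul, h1, pow_mul]; norm_num
    have h3' : t ^ q = t := by rw [hsub1, pow_succ, h3, one_mul]
    apply (algebraMap F (AlgebraicClosure F)).injective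
    rw [map_pow, ← ht.2, hL, inv_pow, h3']
  have hφσ : ∀ x, (dickson 1 (1 : F) l).eval (x ^ q) = ((dickson 1 (1 : F) l).eval x) ^ q := by
    intro x; rw [← hσ, ← hσ, dick_hom]
  set φ : F → F := fun x => (dickson 1 (1 : F) l).eval x with hφ
  have hsq : ∀ x : F, (x ^ q) ^ q = x := by
    intro x; rw [← pow_mul, ← sq, ← hQ, FiniteField.pow_card]
  have hs1 : ∑ x ∈ Finset.univ.filter (fun b : F => b ^ q = b), quadraticChar F (φ x) = q - l := by
    have : ∀ x ∈ Finset.univ.filter (fun b : F => b ^ q = b), quadraticChar F (φ x) =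
        1 - if φ x = 0 then 1 else 0 := by
      intro x hx
      simp only [Finset.mem_filter, Finset.mem_univ, true_and] at hx
      split_ifs with h
      · rw [h, quadraticChar_zero]; rfl
      · rw [sub_zero]
        refine chi_sub (b := Units.mk0 (φ x) h) hQ (by omega) hF ?_
        ext
        push_cast
        rw [Units.val_mk0]
        apply mul_right_cancel₀ h
        rw [← pow_succ, ← hsub1, one_mul, hφ]
        simp only
        rw [← hφσ, hx]
    rw [Finset.sum_congr rfl this, Finset.sum_sub_distrib, ← Finset.sum_filter,
      Finset.filter_filter, Finset.sum_const, Finset.sum_const]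
    simp only [nsmul_eq_mul, mul_one]
    rw [hcK0]
    congr 2
    conv_rhs => rw [← hz]
    congr 1
    ext x
    simp only [Finset.mem_filter, Finset.mem_univ, true_and]
    exact ⟨fun h => h.2, fun h => ⟨hroot x h, h⟩⟩
  set X := Finset.univ.filter (fun x : F => ¬ x ^ q = x ∧ quadraticChar F (φ x) = 1) with hX
  have hs2 : ∑ x ∈ Finset.univ.filter (fun b : F => ¬ b ^ q = b), quadraticChar F (φ x) =
      2 * X.card - (q ^ 2 - q) := by
    have : ∀ x ∈ Finset.univ.filter (fun b : F => ¬ b ^ q = b), quadraticChar F (φ x) =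
        (if quadraticChar F (φ x) = 1 then 2 else 0) - 1 := by
      intro x hx
      simp only [Finset.mem_filter, Finset.mem_univ, true_and] at hx
      have h0 : φ x ≠ 0 := fun h => hx (hroot x h)
      rcases quadraticChar_dichotomy h0 with h | h <;> rw [h] <;> norm_num
    rw [Finset.sum_congr rfl this, Finset.sum_sub_distrib, ← Finset.sum_filter,
      Finset.filter_filter, Finset.sum_const, Finset.sum_const, ← hX]
    have hcomp := Finset.card_filter_add_card_filter_not (s := (Finset.univ : Finset F))
      (fun b : F => b ^ q = b)
    rw [Finset.card_univ, hQ] at hcomp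
    have hcomp' : ((Finset.univ.filter (fun b : F => b ^ q = b)).card : ℤ) +
      (Finset.univ.filter (fun b : F => ¬ b ^ q = b)).card = q ^ 2 := by exact_mod_cast hcomp
    simp only [nsmul_eq_mul, mul_one]
    linarith
  have hχneg : quadraticChar F (-1) = 1 := by
    have : ((-1 : Fˣ) : F) = -1 := by simp
    rw [← this]
    exact chi_sub hQ (by omega) hF (Even.neg_one_pow (Nat.even_iff.mpr (by omega)))
  have hX4 : 4 ∣ X.card := by
    apply four_dvd_card X (fun x => x ^ q) hsq
    · intro x; exact Odd.neg_pow (Nat.odd_iff.mpr (by omega)) x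
    · intro x hx
      simp only [hX, Finset.mem_filter, Finset.mem_univ, true_and] at hx ⊢
      rw [Odd.neg_pow (Nat.odd_iff.mpr (by omega))]
      refine ⟨fun h => hx.1 (neg_injective h), ?_⟩
      simp only [hφ] at hx ⊢
      rw [dick_neg hl, ← neg_one_mul, map_mul, hχneg, one_mul, hx.2]
    · intro x hx
      simp only [hX, Finset.mem_filter, Finset.mem_univ, true_and] at hx ⊢
      refine ⟨fun h => hx.1 ?_, ?_⟩
      · rw [hsq] at h; exact h.symm
      · simp only [hφ] at hx ⊢
        rw [hφσ, map_pow, hx.2, one_pow]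
    · intro x hx h
      simp only [hX, Finset.mem_filter, Finset.mem_univ, true_and] at hx
      have : x = 0 := by
        have : 2 * x = 0 := by linear_combination h
        exact (mul_eq_zero.mp this).resolve_left (two_ne' hF)
      apply hx.1
      rw [this, zero_pow (by omega)]
    · intro x hx
      simp only [hX, Finset.mem_filter, Finset.mem_univ, true_and] at hx
      exact hx.1
    · intro x hx h
      simp only [hX, Finset.mem_filter, Finset.mem_univ, true_and] at hx
      have h0 : φ x ≠ 0 := fun h => hx.1 (hroot x h)
      have h1 : φ x ^ (q - 1) = -1 := by
        apply mul_right_cancel₀ h0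
        rw [← pow_succ, ← hsub1]
        simp only [hφ]
        rw [← hφσ, h, dick_neg hl, neg_one_mul]
      have h2 := (FiniteField.isSquare_iff hF h0).1 ((quadraticChar_one_iff_isSquare h0).1 hx.2)
      rw [half_card hQ (by omega), pow_mul, h1,
        Odd.neg_one_pow (Nat.odd_iff.mpr (by omega))] at h2
      apply two_ne' hF
      linear_combination -h2
  have hsplit := Finset.sum_filter_add_sum_filter_not (Finset.univ : Finset F)
    (fun b : F => b ^ q = b) (fun x => quadraticChar F (φ x))
  rw [hs1, hs2] at hsplit
  have hgoal : ∑ x : F, quadraticChar F (φ x) - (1 - l) =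
      2 * (X.card : ℤ) + ((q : ℤ) - 1) * (1 - q) := by
    rw [← hsplit]; ring
  obtain ⟨c, hc⟩ := hX4
  have hq' : (q : ℤ) = 8 * ((q / 8 : ℕ) : ℤ) + 1 := by
    have := Nat.div_add_mod q 8
    rw [hq8] at this
    exact_mod_cast this.symm
  refine (show (8 : ℤ) ∣ ∑ x : F, quadraticChar F (φ x) - (1 - l) from ?_)
  rw [hgoal, hc, hq']
  push_cast
  exact ⟨c - 8 * (q / 8 : ℤ) * (q / 8 : ℤ), by ring⟩
end mod8

section final
variable {F : Type} [Field F] [Fintype F] [DecidableEq F] {q : ℕ}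

lemma two_S (hF : ringChar F ≠ 2) {l : ℕ} (hc : l.Coprime (Fintype.card F + 1)) :
    2 * ∑ x : F, quadraticChar F ((dickson 1 (1 : F) l).eval x) =
      ∑ t : Fˣ, quadraticChar F ((t : F) ^ l + ((t⁻¹ : Fˣ) : F) ^ l) -
      ∑ t : Fˣ, quadraticChar F ((t : F) ^ 1 + ((t⁻¹ : Fˣ) : F) ^ 1) := by
  have h1 := conv_sum hF (fun x => quadraticChar F ((dickson 1 (1 : F) l).eval x))
  have h2 := conv_sum hF (fun x => quadraticChar F x)
  have h3 := V_sum hF hc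
  have h4 := quadraticChar_sum_zero hF
  simp only [dick_eval] at h1
  simp only [pow_one]
  rw [h1, h2]
  simp only [add_mul, sub_mul, one_mul, Finset.sum_add_distrib, Finset.sum_sub_distrib] at h3 ⊢
  linarith

lemma pow_add_pow (p n : ℕ) [Fact p.Prime] (K : Type*) [Field K] [CharP K p] (x y : K) :
    (x + y) ^ (p ^ n) = x ^ (p ^ n) + y ^ (p ^ n) := add_pow_char_pow x y p n

lemma S_max (p n : ℕ) [Fact p.Prime] [CharP F p] (hn : 0 < n) (hQ : Fintype.card F = (p ^ n) ^ 2)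
    (hF : ringChar F ≠ 2) {l : ℕ} (hl : l.Prime) (hl2 : l % 2 = 1) (hq4 : p ^ n % 4 = 3)
    (h : l ∣ p ^ n - 1 ∨ l ∣ p ^ n + 1) :
    ∑ x : F, quadraticChar F ((dickson 1 (1 : F) l).eval x) = (l - 1) * (p ^ n : ℕ) := by
  have hq1 : 1 < p ^ n := by omega
  have hfrob := pow_add_pow p n F
  have hdQ : l ∣ Fintype.card F - 1 := by
    rw [card_sub_one hQ]
    rcases h with h | h
    · exact h.mul_right _
    · exact h.mul_left _
  have hc : l.Coprime (Fintype.card F + 1) := by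
    rw [Nat.Prime.coprime_iff_not_dvd hl]
    intro hd
    have h2 : l ∣ 2 := by
      have := Nat.dvd_sub hd hdQ
      rwa [show Fintype.card F + 1 - (Fintype.card F - 1) = 2 by
        have := Fintype.card_pos (α := F); omega] at this
    have := Nat.le_of_dvd (by norm_num) h2
    have := hl.two_le
    omega
  have h2S := two_S hF hc
  have hT1 := caseA hQ hq1 hF hfrob (d := 1) (by norm_num) (by omega)
  have hTl : ∑ t : Fˣ, quadraticChar F ((t : F) ^ l + ((t⁻¹ : Fˣ) : F) ^ l) =
      2 * l * (p ^ n : ℕ) := by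
    rcases h with h | h
    · obtain ⟨ψ, hψ, hψq⟩ := exists_addChar (F := F) p n
      have hd2 : 2 * l ∣ p ^ n - 1 :=
        Nat.Coprime.mul_dvd_of_dvd_of_dvd
          ((Nat.coprime_primes Nat.prime_two hl).2 (by omega)) (by omega) h
      have b1 := caseB hQ hF ψ hψ hψq (d := 1) (by norm_num) hq4 (by omega)
      have bl := caseB hQ hF ψ hψ hψq hl2 hq4 hd2
      rw [hT1] at b1
      have hq0 : ((p ^ n : ℕ) : ℂ) ≠ 0 := by
        exact_mod_cast (by omega : p ^ n ≠ 0)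
      have hG : (∑ a : Fˣ, (quadraticChar F (a : F) : ℂ) * ψ a) = (p ^ n : ℕ) := by
        have : (2 * ((p ^ n : ℕ) : ℂ)) ≠ 0 := mul_ne_zero two_ne_zero hq0
        apply mul_left_cancel₀ this
        push_cast at b1 ⊢
        linear_combination b1
      rw [hG] at bl
      have : ((∑ t : Fˣ, quadraticChar F ((t : F) ^ l + ((t⁻¹ : Fˣ) : F) ^ l) : ℤ) : ℂ) =
          ((2 * l * (p ^ n : ℕ) : ℤ) : ℂ) := by
        apply mul_right_cancel₀ hq0
        rw [bl]; push_cast; ring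
      exact_mod_cast this
    · refine caseA hQ hq1 hF hfrob hl2 ?_
      refine Nat.Coprime.mul_dvd_of_dvd_of_dvd ?_ (by omega) h
      have : Nat.Coprime (2 ^ 2) l :=
        Nat.Coprime.pow_left 2 ((Nat.coprime_primes Nat.prime_two hl).2 (by omega))
      simpa using this
  rw [hTl, hT1] at h2S
  push_cast at h2S ⊢
  linarith

lemma not_dvd_sq_add_one {l : ℕ} (hl : l.Prime) (hl4 : l % 4 = 3) (a : ℕ) : ¬ l ∣ a ^ 2 + 1 := by
  intro h
  haveI := Fact.mk hl
  have h1 : ((a ^ 2 + 1 : ℕ) : ZMod l) = 0 := (ZMod.natCast_eq_zero_iff _ _).2 h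
  push_cast at h1
  have h2 : (a : ZMod l) ^ 2 = -1 := by linear_combination h1
  exact ZMod.mod_four_ne_three_of_sq_eq_neg_one h2 hl4

lemma S_not (p n : ℕ) [Fact p.Prime] [CharP F p] (hn : 0 < n) (hp4 : p % 4 = 3)
    (hQ : Fintype.card F = (p ^ n) ^ 2)
    (hF : ringChar F ≠ 2) {l : ℕ} (hl : l.Prime) (hl4 : l % 4 = 3)
    (hS : ∑ x : F, quadraticChar F ((dickson 1 (1 : F) l).eval x) = (l - 1) * (p ^ n : ℕ)) :
    p ^ n % 4 = 3 ∧ (l ∣ p ^ n - 1 ∨ l ∣ p ^ n + 1) := by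
  have hq1 : 1 < p ^ n := Nat.one_lt_pow hn.ne' (Fact.out : p.Prime).one_lt
  have hd : l ∣ p ^ n - 1 ∨ l ∣ p ^ n + 1 := by
    have h1 : l ∣ Fintype.card F ^ 2 - 1 := by
      by_contra hnd
      have := perm_sum hF ((Nat.Prime.coprime_iff_not_dvd hl).2 hnd)
      rw [this] at hS
      have h3 : (l : ℤ) - 1 ≠ 0 := by omega
      have h4 : ((p ^ n : ℕ) : ℤ) ≠ 0 := by omega
      exact (mul_ne_zero h3 h4) hS.symm
    have h2 : Fintype.card F ^ 2 - 1 = (Fintype.card F + 1) * (Fintype.card F - 1) := by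
      have := Nat.sq_sub_sq (Fintype.card F) 1
      simpa using this
    rw [h2] at h1
    rcases hl.dvd_mul.1 h1 with h | h
    · rw [hQ] at h
      exact absurd h (not_dvd_sq_add_one hl hl4 _)
    · rw [card_sub_one hQ] at h
      exact hl.dvd_mul.1 h
  refine ⟨?_, hd⟩
  rcases Nat.even_or_odd' n with ⟨m, hm | hm⟩
  · exfalso
    have hr : p ^ n = (p ^ m) ^ 2 := by rw [hm, mul_comm, pow_mul]
    have hodd : p ^ m % 2 = 1 := by
      have : p % 2 = 1 := by omega
      exact Nat.odd_iff.1 ((Nat.odd_iff.2 this).pow)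
    have hq8 : p ^ n % 8 = 1 := by
      rw [hr, Nat.pow_mod]
      have : p ^ m % 8 = 1 ∨ p ^ m % 8 = 3 ∨ p ^ m % 8 = 5 ∨ p ^ m % 8 = 7 := by omega
      rcases this with h | h | h | h <;> rw [h]
    have hd' : l ∣ p ^ n - 1 := by
      rcases hd with h | h
      · exact h
      · rw [hr] at h
        exact absurd h (not_dvd_sq_add_one hl hl4 _)
    have h4 : 4 * l ∣ p ^ n - 1 := by
      refine Nat.Coprime.mul_dvd_of_dvd_of_dvd ?_ (by omega) hd'
      have : Nat.Coprime (2 ^ 2) l :=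
        Nat.Coprime.pow_left 2 ((Nat.coprime_primes Nat.prime_two hl).2 (by omega))
      simpa using this
    haveI : CharP (AlgebraicClosure F) p :=
      charP_of_injective_algebraMap (algebraMap F (AlgebraicClosure F)).injective p
    have h8 := mod8 hQ hF (iterateFrobenius F p n) (fun x => rfl) hq8 hq1
      (l := l) (by omega) h4 (pow_add_pow p n _)
    rw [hS] at h8
    have e1 : ((p ^ n : ℕ) : ℤ) = 8 * ((p ^ n / 8 : ℕ) : ℤ) + 1 := by omega
    rw [e1, show ((l : ℤ) - 1) * (8 * ((p ^ n / 8 : ℕ) : ℤ) + 1) - (1 - l) =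
      8 * (((l : ℤ) - 1) * ((p ^ n / 8 : ℕ) : ℤ)) + 2 * (l - 1) by ring] at h8
    have h9 := (Int.dvd_add_right (Dvd.intro _ rfl)).1 h8
    omega
  · rw [hm, pow_succ, pow_mul, Nat.mul_mod, Nat.pow_mod, Nat.pow_mod p, hp4]
    norm_num
    
lemma dvd_iff_zmod {l q : ℕ} (hq : 1 ≤ q) :
    ((q : ZMod l) = 1 ∨ (q : ZMod l) = -1) ↔ (l ∣ q - 1 ∨ l ∣ q + 1) := by
  rw [← ZMod.natCast_eq_zero_iff, ← ZMod.natCast_eq_zero_iff, Nat.cast_sub hq]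
  push_cast
  rw [sub_eq_zero, add_eq_zero_iff_eq_neg]

lemma charP_of_card {p n : ℕ} (hp : p.Prime) (hQ : Fintype.card F = (p ^ n) ^ 2) : CharP F p := by
  obtain ⟨r, hr⟩ := CharP.exists F
  obtain ⟨k, hrp, hk⟩ := FiniteField.card F r
  have : p = r := by
    have h1 : r ∣ (p ^ n) ^ 2 := by
      rw [← hQ, hk]; exact dvd_pow_self r k.pos.ne'
    exact ((Nat.prime_dvd_prime_iff_eq hrp hp).1
      (hrp.dvd_of_dvd_pow (hrp.dvd_of_dvd_pow h1))).symm
  rw [this]; exact hr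

end final

theorem statement2 (l p : ℕ) (hl : l.Prime) (hl4 : l % 4 = 3)
    (hp : p.Prime) (hp4 : p % 4 = 3) (hne : p ≠ l)
    (n : ℕ) (hn : 0 < n) :
    chebMaximal l (p ^ n) ↔
      (p ^ n % 4 = 3 ∧ ((p ^ n : ZMod l) = 1 ∨ (p ^ n : ZMod l) = -1)) := by
  classical
  haveI := Fact.mk hp
  have hz := dvd_iff_zmod (l := l) (q := p ^ n) (Nat.one_le_pow _ _ hp.pos)
  push_cast at hz
  rw [hz]
  have key : ∀ (F : Type) [Field F] [Fintype F], Fintype.card F = (p ^ n) ^ 2 →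
      CharP F p ∧ ringChar F ≠ 2 ∧ (chebAffineCount F l = (p ^ n) ^ 2 + (l - 1) * p ^ n ↔
        ∑ x : F, quadraticChar F ((dickson 1 (1 : F) l).eval x) = (l - 1) * (p ^ n : ℕ)) := by
    intro F _ _ hQ
    have hc : CharP F p := charP_of_card hp hQ
    have hF : ringChar F ≠ 2 := by
      rw [ringChar.eq_iff.mpr hc]; omega
    refine ⟨hc, hF, ?_⟩
    have h := affine_count hF (fun x => (dickson 1 (1 : F) l).eval x)
    rw [chebAffineCount, ← Int.natCast_inj, h, hQ]
    push_cast [Nat.cast_sub hl.one_le]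
    constructor <;> intro h <;> linarith
  constructor
  · intro h
    have hn2 : n * 2 ≠ 0 := by omega
    haveI : Fintype (GaloisField p (n * 2)) := Fintype.ofFinite _
    have hQ : Fintype.card (GaloisField p (n * 2)) = (p ^ n) ^ 2 := by
      rw [← Nat.card_eq_fintype_card, GaloisField.card p _ hn2, pow_mul]
    obtain ⟨hc, hF, hiff⟩ := key _ hQ
    exact S_not p n hn hp4 hQ hF hl hl4 (hiff.1 (h _ hQ))
  · rintro ⟨h4, hd⟩ F _ _ hQ
    obtain ⟨hc, hF, hiff⟩ := key _ hQ
    exact hiff.2 (S_max p n hn hQ hF hl (by omega) h4 hd)
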